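/- The all-ones vector of length 2^m − 1 lies in the dual code RM̄(1,m)^⊥ of the shortened first-order Reed–Muller code but not in the shortened code RM̄(m−2,m); consequently RM̄(1,m)^⊥ is spanned by RM̄(m−2,m) together with the all-ones vector, and dim RM̄(1,m)^⊥ = dim RM̄(m−2,m) + 1. -/

import Mathlib

/-- Hamming weight of a vector over `𝔽₂`. -/
def wt {N : ℕ} (c : Fin N → ZMod 2) : ℕ := (Finset.univ.filter (fun x => c x ≠ 0)).card

/-- Generator rows `v_i` of the first-order Reed–Muller code: `v_i(x)` is the `i`-th bit
of the index `x` (the periodic pattern `0^{2^i} 1^{2^i}`). -/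
def vGen (m : ℕ) (i : Fin m) : Fin (2 ^ m) → ZMod 2 :=
  fun x => if Nat.testBit (x : ℕ) (i : ℕ) then 1 else 0

/-- Boolean-product generators of the `r`-th order Reed–Muller code. -/
def vProd (m : ℕ) (s : Finset (Fin m)) : Fin (2 ^ m) → ZMod 2 :=
  fun x => ∏ i ∈ s, vGen m i x

/-- The `r`-th order Reed–Muller code `RM(r,m)` of length `2^m`. -/
def RM (r m : ℕ) : Submodule (ZMod 2) (Fin (2 ^ m) → ZMod 2) :=
  Submodule.span (ZMod 2) {c | ∃ s : Finset (Fin m), s.card ≤ r ∧ c = vProd m s}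

/-- Deletion of the first coordinate. -/
def del (m : ℕ) (c : Fin (2 ^ m) → ZMod 2) : Fin (2 ^ m - 1) → ZMod 2 :=
  fun j => c ⟨(j : ℕ) + 1, by have := j.isLt; omega⟩

/-- The shortened Reed–Muller code `RM̄(r,m)`: codewords of `RM(r,m)` vanishing at the
first coordinate, with that coordinate deleted. -/
def RMbar (r m : ℕ) : Set (Fin (2 ^ m - 1) → ZMod 2) :=
  {u | ∃ c ∈ RM r m, c ⟨0, by positivity⟩ = 0 ∧ u = del m c}

/-- The dual of a code: all vectors orthogonal (w.r.t. the standard bilinear form over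
`𝔽₂`) to every codeword. -/
def dualC {N : ℕ} (W : Set (Fin N → ZMod 2)) : Set (Fin N → ZMod 2) :=
  {u | ∀ w ∈ W, ∑ x, u x * w x = 0}

/-- The all-ones vector. -/
def allones (N : ℕ) : Fin N → ZMod 2 := fun _ => 1

theorem vProd_mem_RM {r m : ℕ} {s : Finset (Fin m)} (hs : s.card ≤ r) : vProd m s ∈ RM r m :=
  Submodule.subset_span ⟨s, hs, rfl⟩

theorem vProd_empty (m : ℕ) : vProd m ∅ = 1 := by
  ext x; simp [vProd]

theorem one_mem_RM (r m : ℕ) : (1 : Fin (2 ^ m) → ZMod 2) ∈ RM r m :=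
  vProd_empty m ▸ vProd_mem_RM (Nat.zero_le r)

theorem vProd_mul_vProd {m : ℕ} (s t : Finset (Fin m)) :
    vProd m s * vProd m t = vProd m (s ∪ t) := by
  have idem : ∀ a : ZMod 2, a * a = a := by decide
  ext x
  simp only [vProd, Pi.mul_apply]
  rw [← Finset.prod_union_inter, ← Finset.sdiff_union_inter (s ∪ t) (s ∩ t),
    Finset.prod_union (Finset.disjoint_sdiff_inter _ _),
    Finset.inter_eq_right.2 (Finset.inter_subset_union (s := s) (t := t)), mul_assoc, idem]

/-- A monomial of degree less than `m` has even weight. -/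
theorem sum_vProd_eq_zero {m : ℕ} {s : Finset (Fin m)} (hs : s.card < m) :
    ∑ x, vProd m s x = 0 := by
  obtain ⟨i, hi⟩ : ∃ i, i ∉ s := by
    by_contra! h
    simp [Finset.eq_univ_of_forall h] at hs
  let flip (x : Fin (2 ^ m)) : Fin (2 ^ m) :=
    ⟨x ^^^ 2 ^ (i : ℕ), Nat.xor_lt_two_pow x.isLt (Nat.pow_lt_pow_right one_lt_two i.isLt)⟩
  have vProd_flip (x) : vProd m s (flip x) = vProd m s x := by
    refine Finset.prod_congr rfl fun j hj => ?_
    have hij : (i : ℕ) ≠ j := fun h => hi (Fin.ext h ▸ hj)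
    simp [vGen, flip, Nat.testBit_xor, hij]
  refine Finset.sum_involution (fun x _ => flip x) ?_ ?_ (fun _ _ => Finset.mem_univ _) ?_
  · intro x _
    rw [vProd_flip, CharTwo.add_self_eq_zero]
  · intro x _ _ h
    have := congrArg (fun y : Fin (2 ^ m) => Nat.testBit y i) h
    simp [flip, Nat.testBit_xor] at this
  · intro x _
    ext
    simp [flip]

theorem sum_mul_eq_zero_of_mem_RM {a b m : ℕ} (hab : a + b < m) {c w : Fin (2 ^ m) → ZMod 2}
    (hc : c ∈ RM a m) (hw : w ∈ RM b m) : ∑ x, c x * w x = 0 := by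
  induction hc, hw using Submodule.span_induction₂ with
  | mem_mem c w hc hw =>
    obtain ⟨s, hs, rfl⟩ := hc
    obtain ⟨t, ht, rfl⟩ := hw
    have := Finset.card_union_le s t
    simpa only [← vProd_mul_vProd, Pi.mul_apply] using
      sum_vProd_eq_zero (s := s ∪ t) (by omega)
  | zero_left => simp
  | zero_right => simp
  | add_left _ _ _ _ _ _ h₁ h₂ => simp [add_mul, Finset.sum_add_distrib, h₁, h₂]
  | add_right _ _ _ _ _ _ h₁ h₂ => simp [mul_add, Finset.sum_add_distrib, h₁, h₂]
  | smul_left k _ _ _ _ h => simp [mul_assoc, ← Finset.mul_sum, h]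
  | smul_right k _ _ _ _ h => simp [mul_left_comm _ k, ← Finset.mul_sum, h]

theorem prod_one_add_vGen_eq_ite {m : ℕ} (x y : Fin (2 ^ m)) :
    ∏ i, (vGen m i x + (1 + vGen m i y)) = if y = x then 1 else 0 := by
  have add_self : ∀ a : ZMod 2, a + (1 + a) = 1 := by decide
  split_ifs with h
  · subst h
    simp [add_self]
  · obtain ⟨i, hi⟩ : ∃ i : Fin m, Nat.testBit x i ≠ Nat.testBit y i := by
      by_contra! hxy
      refine h (Fin.ext (Nat.eq_of_testBit_eq fun i => ?_))
      by_cases him : i < m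
      · exact (hxy ⟨i, him⟩).symm
      · have hle : 2 ^ m ≤ 2 ^ i := Nat.pow_le_pow_right two_pos (not_lt.1 him)
        rw [Nat.testBit_lt_two_pow (x.isLt.trans_le hle),
          Nat.testBit_lt_two_pow (y.isLt.trans_le hle)]
    refine Finset.prod_eq_zero (Finset.mem_univ i) ?_
    revert hi
    simp only [vGen]
    cases Nat.testBit x i <;> cases Nat.testBit y i <;> decide

/-- The algebraic normal form of a Boolean function. -/
theorem eq_sum_smul_vProd {m : ℕ} (c : Fin (2 ^ m) → ZMod 2) :
    c = ∑ s : Finset (Fin m), (∑ y, c y * ∏ i ∈ sᶜ, (1 + vGen m i y)) • vProd m s := by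
  ext x
  calc c x = ∑ y, c y * ∏ i, (vGen m i x + (1 + vGen m i y)) := by
        simp [prod_one_add_vGen_eq_ite]
    _ = ∑ y, ∑ s : Finset (Fin m),
          c y * ((∏ i ∈ s, vGen m i x) * ∏ i ∈ sᶜ, (1 + vGen m i y)) := by
        simp [Finset.prod_add, Finset.mul_sum, Finset.compl_eq_univ_sdiff]
    _ = _ := by
        rw [Finset.sum_comm]
        simp only [Finset.sum_apply, Pi.smul_apply, smul_eq_mul, Finset.sum_mul, vProd]
        refine Finset.sum_congr rfl fun s _ => Finset.sum_congr rfl fun y _ => ?_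
        ring

theorem prod_one_add_vGen_mem_RM {r m : ℕ} {s : Finset (Fin m)} (hs : s.card ≤ r) :
    (fun y => ∏ i ∈ s, (1 + vGen m i y)) ∈ RM r m := by
  have : (fun y => ∏ i ∈ s, (1 + vGen m i y)) = ∑ t ∈ s.powerset, vProd m t := by
    ext y
    simp [Finset.prod_one_add, vProd]
  rw [this]
  exact Submodule.sum_mem _ fun t ht =>
    vProd_mem_RM ((Finset.card_le_card (Finset.mem_powerset.1 ht)).trans hs)

theorem mem_RM_of_forall_sum_mul_eq_zero {a b m : ℕ} (hab : m ≤ a + b + 1)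
    {c : Fin (2 ^ m) → ZMod 2} (hc : ∀ w ∈ RM a m, ∑ x, c x * w x = 0) : c ∈ RM b m := by
  rw [eq_sum_smul_vProd c]
  refine Submodule.sum_mem _ fun s _ => ?_
  by_cases hs : s.card ≤ b
  · exact Submodule.smul_mem _ _ (vProd_mem_RM hs)
  · have hcard : sᶜ.card ≤ a := by
      rw [Finset.card_compl, Fintype.card_fin]
      omega
    rw [hc _ (prod_one_add_vGen_mem_RM hcard), zero_smul]
    exact zero_mem _

theorem Fin.sum_univ_eq_zero_add {M : Type*} [AddCommMonoid M] {N : ℕ} (hN : 0 < N)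
    (f : Fin N → M) :
    ∑ x, f x = f ⟨0, hN⟩ + ∑ j : Fin (N - 1), f ⟨j + 1, by omega⟩ := by
  obtain ⟨n, rfl⟩ := Nat.exists_eq_succ_of_ne_zero hN.ne'
  exact Fin.sum_univ_succ f

theorem sum_eq_zero_add_sum_del {m : ℕ} (c : Fin (2 ^ m) → ZMod 2) :
    ∑ x, c x = c ⟨0, by positivity⟩ + ∑ j, del m c j :=
  Fin.sum_univ_eq_zero_add _ c

theorem exists_del_eq {m : ℕ} (u : Fin (2 ^ m - 1) → ZMod 2) :
    ∃ c, c ⟨0, by positivity⟩ = 0 ∧ del m c = u :=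
  ⟨fun x => if h : (x : ℕ) = 0 then 0 else u ⟨x - 1, by omega⟩, by simp, by ext; simp [del]⟩

theorem sum_allones_pow_two_sub_one {m : ℕ} (hm : m ≠ 0) :
    ∑ j, allones (2 ^ m - 1) j = 1 := by
  have h := Nat.cast_sub (R := ZMod 2) (Nat.one_le_two_pow (n := m))
  have two : (2 : ZMod 2) = 0 := rfl
  simp [allones, h, two, hm]

/-- The shortened Reed–Muller code as a subspace. -/
def RMbarSubmodule (r m : ℕ) : Submodule (ZMod 2) (Fin (2 ^ m - 1) → ZMod 2) where
  carrier := RMbar r m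
  zero_mem' := ⟨0, zero_mem _, rfl, rfl⟩
  add_mem' := by
    rintro _ _ ⟨c, hc, hc0, rfl⟩ ⟨d, hd, hd0, rfl⟩
    exact ⟨c + d, add_mem hc hd, by rw [Pi.add_apply, hc0, hd0, add_zero], rfl⟩
  smul_mem' := by
    rintro k _ ⟨c, hc, hc0, rfl⟩
    exact ⟨k • c, Submodule.smul_mem _ k hc, by rw [Pi.smul_apply, hc0, smul_zero], rfl⟩

theorem span_RMbar (r m : ℕ) : Submodule.span (ZMod 2) (RMbar r m) = RMbarSubmodule r m :=
  Submodule.span_eq (RMbarSubmodule r m)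

theorem sum_eq_zero_of_mem_RMbar {r m : ℕ} (hr : r < m) {u : Fin (2 ^ m - 1) → ZMod 2}
    (hu : u ∈ RMbar r m) : ∑ j, u j = 0 := by
  obtain ⟨c, hc, hc0, rfl⟩ := hu
  have h := sum_mul_eq_zero_of_mem_RM (b := 0) hr hc (one_mem_RM 0 m)
  simp only [Pi.one_apply, mul_one] at h
  rwa [sum_eq_zero_add_sum_del, hc0, zero_add] at h

theorem allones_mem_dualC_RMbar {r m : ℕ} (hr : r < m) :
    allones (2 ^ m - 1) ∈ dualC (RMbar r m) := fun w hw => by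
  simpa [allones] using sum_eq_zero_of_mem_RMbar hr hw

theorem allones_notMem_RMbar {r m : ℕ} (hr : r < m) :
    allones (2 ^ m - 1) ∉ RMbar r m := fun h => by
  have h0 := sum_eq_zero_of_mem_RMbar hr h
  rw [sum_allones_pow_two_sub_one (by omega)] at h0
  exact one_ne_zero h0

theorem RMbar_subset_dualC_RMbar {a b m : ℕ} (hab : a + b < m) :
    RMbar b m ⊆ dualC (RMbar a m) := by
  rintro _ ⟨c, hc, hc0, rfl⟩ _ ⟨w, hw, -, rfl⟩
  have h := sum_mul_eq_zero_of_mem_RM (by omega) hc hw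
  rwa [sum_eq_zero_add_sum_del (fun x => c x * w x), hc0, zero_mul, zero_add] at h

/-- An even-weight vector in the dual of a shortened Reed–Muller code lies in the shortened
dual code. -/
theorem mem_RMbar_of_mem_dualC {a b m : ℕ} (hab : m ≤ a + b + 1)
    {u : Fin (2 ^ m - 1) → ZMod 2} (hu : u ∈ dualC (RMbar a m)) (hsum : ∑ j, u j = 0) :
    u ∈ RMbar b m := by
  obtain ⟨c, hc0, rfl⟩ := exists_del_eq u
  refine ⟨c, mem_RM_of_forall_sum_mul_eq_zero hab fun w hw => ?_, hc0, rfl⟩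
  let w₀ := w ⟨0, by positivity⟩
  have h := hu (del m (w - w₀ • 1))
    ⟨_, sub_mem hw (Submodule.smul_mem _ _ (one_mem_RM a m)), by simp [w₀], rfl⟩
  have hdel (j) : del m (w - w₀ • 1) j = del m w j - w₀ := by simp [del]
  simp only [hdel, mul_sub, Finset.sum_sub_distrib, ← Finset.sum_mul, hsum, zero_mul,
    sub_zero] at h
  rw [sum_eq_zero_add_sum_del (fun x => c x * w x), hc0, zero_mul, zero_add]
  exact h

theorem dualC_RMbar {a b m : ℕ} (hab : a + b + 1 = m) :
    dualC (RMbar a m) =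
      ↑(RMbarSubmodule b m ⊔ Submodule.span (ZMod 2) {allones (2 ^ m - 1)}) := by
  have hone := allones_mem_dualC_RMbar (r := a) (m := m) (by omega)
  ext u
  simp only [SetLike.mem_coe, Submodule.mem_sup, Submodule.mem_span_singleton]
  constructor
  · intro hu
    refine ⟨u - (∑ j, u j) • allones _, mem_RMbar_of_mem_dualC hab.ge ?_ ?_, _, ⟨_, rfl⟩,
      sub_add_cancel _ _⟩
    · intro w hw
      simp [sub_mul, mul_assoc, Finset.sum_sub_distrib, ← Finset.mul_sum, hu w hw, hone w hw]
    · simp [Finset.sum_sub_distrib, ← Finset.mul_sum,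
        sum_allones_pow_two_sub_one (show m ≠ 0 by omega)]
  · rintro ⟨v, hv, _, ⟨k, rfl⟩, rfl⟩ w hw
    simp [add_mul, mul_assoc, Finset.sum_add_distrib, ← Finset.mul_sum, hone w hw,
      RMbar_subset_dualC_RMbar (show a + b < m by omega) hv w hw]

/-- The all-ones vector of length `2^m - 1` lies in `RM̄(1,m)^⊥` but not in
`RM̄(m−2,m)`; consequently `RM̄(1,m)^⊥` is spanned by `RM̄(m−2,m)` together with the
all-ones vector, and its dimension is `dim RM̄(m−2,m) + 1`. -/
theorem stmt11 (m : ℕ) (hm : 2 ≤ m) :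
    allones (2 ^ m - 1) ∈ dualC (RMbar 1 m) ∧
    allones (2 ^ m - 1) ∉ RMbar (m - 2) m ∧
    dualC (RMbar 1 m)
      = ↑(Submodule.span (ZMod 2) (RMbar (m - 2) m ∪ {allones (2 ^ m - 1)})) ∧
    Module.finrank (ZMod 2) ↥(Submodule.span (ZMod 2) (dualC (RMbar 1 m)))
      = Module.finrank (ZMod 2) ↥(Submodule.span (ZMod 2) (RMbar (m - 2) m)) + 1 := by
  have hdual := dualC_RMbar (show 1 + (m - 2) + 1 = m by omega)
  have hnot := allones_notMem_RMbar (show m - 2 < m by omega)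
  refine ⟨allones_mem_dualC_RMbar (by omega), hnot, ?_, ?_⟩
  · rw [hdual, Submodule.span_union, span_RMbar]
  · rw [hdual, Submodule.span_eq, span_RMbar]
    exact Submodule.finrank_sup_span_singleton hnot
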